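/- Let X and Y be measurable spaces and let J be a probability measure on X × Y (with the product σ-algebra), with marginals P = J.map(fst) on X and Q = J.map(snd) on Y. Then J is perfect if and only if both P and Q are perfect. -/

import Mathlib

open MeasureTheory

/-- A measure `μ` on a measurable space `Z` is *perfect* if for every measurable
function `f : Z → ℝ` there exists a Borel set `E ⊆ range f` with
`μ (f ⁻¹' E) = μ univ`. -/
def IsPerfect {Z : Type*} [MeasurableSpace Z] (μ : Measure Z) : Prop :=
  ∀ f : Z → ℝ, Measurable f →
    ∃ E : Set ℝ, MeasurableSet E ∧ E ⊆ Set.range f ∧ μ (f ⁻¹' E) = μ Set.univ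

/-- A finite measure on a Polish space is concentrated on the preimage of a Borel subset of the
range of any given continuous function. -/
theorem exists_measurableSet_subset_range_of_continuous {S : Type*} [TopologicalSpace S]
    [PolishSpace S] [MeasurableSpace S] [BorelSpace S] (μ : Measure S) [IsFiniteMeasure μ]
    {f : S → ℝ} (hf : Continuous f) :
    ∃ E : Set ℝ, MeasurableSet E ∧ E ⊆ Set.range f ∧ μ (f ⁻¹' E) = μ Set.univ := by
  have hK (n : ℕ) : ∃ K : Set S, IsCompact K ∧ μ Set.univ < μ K + ((n : ENNReal) + 1)⁻¹ := by
    obtain ⟨K, -, hK, h⟩ := MeasurableSet.univ.exists_isCompact_lt_add (measure_ne_top μ _)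
      (ε := ((n : ENNReal) + 1)⁻¹) (by simp)
    exact ⟨K, hK, h⟩
  choose K hKc hKμ using hK
  refine ⟨⋃ n, f '' K n, .iUnion fun n ↦ ((hKc n).image hf).measurableSet,
    Set.iUnion_subset fun n ↦ Set.image_subset_range _ _, ?_⟩
  refine le_antisymm (measure_mono (Set.subset_univ _)) ?_
  refine ENNReal.le_of_forall_pos_le_add fun ε hε _ ↦ ?_
  obtain ⟨n, hn⟩ := ENNReal.exists_inv_nat_lt (a := (ε : ENNReal)) (by simpa using hε.ne')
  refine (hKμ n).le.trans (add_le_add (measure_mono fun x hx ↦ ?_) (le_trans ?_ hn.le))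
  · exact Set.mem_iUnion.2 ⟨n, x, hx, rfl⟩
  · exact ENNReal.inv_le_inv.2 le_self_add

theorem isPerfect_of_standardBorelSpace {S : Type*} [MeasurableSpace S] [StandardBorelSpace S]
    (μ : Measure S) [IsFiniteMeasure μ] : IsPerfect μ := by
  intro f hf
  obtain ⟨t, hB, hP⟩ := ‹StandardBorelSpace S›.polish
  obtain ⟨t', ht', hft', hP'⟩ := hf.exists_continuous
  have hB' : @BorelSpace S t' _ :=
    ⟨hB.measurable_eq.trans (borel_eq_borel_of_le hP' hP ht').symm⟩
  exact @exists_measurableSet_subset_range_of_continuous S t' hP' _ hB' μ _ f hft'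

section Factorization

variable {X Y : Type*} [MeasurableSpace X] [MeasurableSpace Y]

/-- Countably many subsets of `X × Y`, each a preimage under a product of measurable real
functions, are preimages under a common product of measurable real functions. -/
theorem exists_measurable_prodMap_of_forall {s : ℕ → Set (X × Y)}
    (hs : ∀ n, ∃ (g : X → ℝ) (h : Y → ℝ), Measurable g ∧ Measurable h ∧
      MeasurableSet[MeasurableSpace.comap (Prod.map g h) inferInstance] (s n)) :
    ∃ (g : X → ℝ) (h : Y → ℝ), Measurable g ∧ Measurable h ∧
      ∀ n, MeasurableSet[MeasurableSpace.comap (Prod.map g h) inferInstance] (s n) := by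
  choose g h hg hh hs using hs
  have he := measurableEmbedding_embeddingReal (ℕ → ℝ)
  set e := embeddingReal (ℕ → ℝ)
  obtain ⟨d, hd, hde⟩ := he.exists_measurable_extend measurable_id fun _ ↦ inferInstance
  have hde (u : ℕ → ℝ) : d (e u) = u := congrFun hde u
  refine ⟨fun x ↦ e fun n ↦ g n x, fun y ↦ e fun n ↦ h n y,
    he.measurable.comp (measurable_pi_lambda _ hg),
    he.measurable.comp (measurable_pi_lambda _ hh), fun n ↦ ?_⟩
  obtain ⟨t, ht, hts⟩ := hs n
  have hm : Measurable fun p : ℝ × ℝ ↦ (d p.1 n, d p.2 n) := by fun_prop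
  refine ⟨_, hm ht, ?_⟩
  rw [← hts]
  ext p
  simp [hde, Prod.map]

theorem MeasurableSet.exists_measurable_prodMap {s : Set (X × Y)} (hs : MeasurableSet s) :
    ∃ (g : X → ℝ) (h : Y → ℝ), Measurable g ∧ Measurable h ∧
      MeasurableSet[MeasurableSpace.comap (Prod.map g h) inferInstance] s := by
  induction s, hs using MeasurableSpace.induction_on_inter generateFrom_prod.symm
    isPiSystem_prod with
  | empty => exact ⟨0, 0, measurable_const, measurable_const, @MeasurableSet.empty _ (_)⟩
  | basic t ht =>
    obtain ⟨a, ha, b, hb, rfl⟩ := ht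
    refine ⟨a.indicator 1, b.indicator 1, measurable_one.indicator ha,
      measurable_one.indicator hb, {1} ×ˢ {1}, by measurability, ?_⟩
    ext p
    simp [Prod.ext_iff, Set.indicator_eq_one_iff_mem]
  | compl t _ ih =>
    obtain ⟨g, h, hg, hh, ht⟩ := ih
    exact ⟨g, h, hg, hh, ht.compl⟩
  | iUnion t _ _ ih =>
    obtain ⟨g, h, hg, hh, ht⟩ := exists_measurable_prodMap_of_forall ih
    exact ⟨g, h, hg, hh, .iUnion ht⟩

/-- A measurable real function on a product factors through a product of measurable real
functions. -/
theorem Measurable.exists_eq_comp_prodMap {f : X × Y → ℝ} (hf : Measurable f) :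
    ∃ (g : X → ℝ) (h : Y → ℝ) (F : ℝ × ℝ → ℝ), Measurable g ∧ Measurable h ∧ Measurable F ∧
      f = F ∘ Prod.map g h := by
  obtain ⟨q, hq⟩ := exists_surjective_nat ℚ
  obtain ⟨g, h, hg, hh, hm⟩ := exists_measurable_prodMap_of_forall
    (s := fun n ↦ f ⁻¹' Set.Iio (q n : ℝ)) fun n ↦ (hf measurableSet_Iio).exists_measurable_prodMap
  have hfm : Measurable[MeasurableSpace.comap (Prod.map g h) inferInstance] f := by
    intro u hu
    rw [BorelSpace.measurable_eq (α := ℝ), Real.borel_eq_generateFrom_Iio_rat] at hu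
    refine @measurable_generateFrom _ _ (_) _ _ (fun t ht ↦ ?_) _ hu
    simp only [Set.mem_iUnion, Set.mem_singleton_iff] at ht
    obtain ⟨a, rfl⟩ := ht
    obtain ⟨n, rfl⟩ := hq a
    exact hm n
  obtain ⟨F, hF, hfF⟩ := hfm.exists_eq_measurable_comp
  exact ⟨g, h, F, hg, hh, hF, hfF⟩

end Factorization

theorem IsPerfect.map {Z W : Type*} [MeasurableSpace Z] [MeasurableSpace W] {μ : Measure Z}
    (hμ : IsPerfect μ) {φ : Z → W} (hφ : Measurable φ) : IsPerfect (μ.map φ) := by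
  intro f hf
  obtain ⟨E, hE, hEf, hμE⟩ := hμ (f ∘ φ) (hf.comp hφ)
  refine ⟨E, hE, hEf.trans (Set.range_comp_subset_range _ _), ?_⟩
  rwa [Measure.map_apply hφ (hf hE), Measure.map_apply hφ .univ]

theorem isPerfect_of_isPerfect_map_fst_of_isPerfect_map_snd {X Y : Type*} [MeasurableSpace X]
    [MeasurableSpace Y] {J : Measure (X × Y)} [IsFiniteMeasure J]
    (hX : IsPerfect (J.map Prod.fst)) (hY : IsPerfect (J.map Prod.snd)) : IsPerfect J := by
  intro f hf
  obtain ⟨g, h, F, hg, hh, hF, rfl⟩ := hf.exists_eq_comp_prodMap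
  obtain ⟨A, hA, hAg, hJA⟩ := hX g hg
  obtain ⟨B, hB, hBh, hJB⟩ := hY h hh
  rw [Measure.map_apply measurable_fst (hg hA), Measure.map_apply measurable_fst .univ] at hJA
  rw [Measure.map_apply measurable_snd (hh hB), Measure.map_apply measurable_snd .univ] at hJB
  have hgh : Measurable (Prod.map g h) := hg.prodMap hh
  have hS : MeasurableSet (A ×ˢ B) := hA.prod hB
  have := hS.standardBorel
  have hae : ∀ᵐ p ∂J, Prod.map g h p ∈ A ×ˢ B := by
    have h₁ : ∀ᵐ p ∂J, g p.1 ∈ A :=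
      (ae_iff_measure_eq (measurable_fst (hg hA)).nullMeasurableSet).2 hJA
    have h₂ : ∀ᵐ p ∂J, h p.2 ∈ B :=
      (ae_iff_measure_eq (measurable_snd (hh hB)).nullMeasurableSet).2 hJB
    filter_upwards [h₁, h₂] with p hp₁ hp₂ using ⟨hp₁, hp₂⟩
  obtain ⟨E, hE, hEF, hμE⟩ := isPerfect_of_standardBorelSpace
    ((J.map (Prod.map g h)).comap ((↑) : ↥(A ×ˢ B) → ℝ × ℝ)) (fun p ↦ F p)
    (hF.comp measurable_subtype_coe)
  refine ⟨E, hE, fun z hz ↦ ?_, le_antisymm (measure_mono (Set.subset_univ _)) ?_⟩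
  · obtain ⟨⟨⟨a, b⟩, ha, hb⟩, rfl⟩ := hEF hz
    obtain ⟨x, rfl⟩ := hAg ha
    obtain ⟨y, rfl⟩ := hBh hb
    exact ⟨(x, y), rfl⟩
  · have hpre : (fun p : ↥(A ×ˢ B) ↦ F p) ⁻¹' E = Subtype.val ⁻¹' (F ⁻¹' E) := rfl
    rw [hpre, (MeasurableEmbedding.subtype_coe hS).comap_apply,
      (MeasurableEmbedding.subtype_coe hS).comap_apply, Subtype.image_preimage_coe,
      Set.image_univ, Subtype.range_coe, Measure.map_apply hgh (hS.inter (hF hE)),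
      Measure.map_apply hgh hS] at hμE
    calc J Set.univ = J (Prod.map g h ⁻¹' (A ×ˢ B)) :=
          ((ae_iff_measure_eq (hgh hS).nullMeasurableSet).1 hae).symm
      _ = J (Prod.map g h ⁻¹' (A ×ˢ B ∩ F ⁻¹' E)) := hμE.symm
      _ ≤ J (F ∘ Prod.map g h ⁻¹' E) := measure_mono fun p hp ↦ hp.2

theorem stmt_4 {X Y : Type*} [MeasurableSpace X] [MeasurableSpace Y]
    (J : Measure (X × Y)) [IsProbabilityMeasure J] :
    IsPerfect J ↔ IsPerfect (J.map Prod.fst) ∧ IsPerfect (J.map Prod.snd) :=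
  ⟨fun h ↦ ⟨h.map measurable_fst, h.map measurable_snd⟩,
    fun h ↦ isPerfect_of_isPerfect_map_fst_of_isPerfect_map_snd h.1 h.2⟩
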